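/- Let d, d', n ∈ ℕ, η, η' > 0, x_1, …, x_n ∈ ℝ^d, y_1, …, y_n ∈ ℝ^{d'}, and let A ∈ ℝ^{n×n} be symmetric positive semidefinite. Define the joint Gaussian PSD model f(x,y) = Σ_{i,j=1}^n A_{ij} e^{−η‖x−x_i‖²} e^{−η'‖y−y_i‖²} e^{−η‖x−x_j‖²} e^{−η'‖y−y_j‖²}. Then for every y ∈ ℝ^{d'}, ∫_{ℝ^d} f(x,y) dx = Σ_{i,j=1}^n B_{ij} e^{−η'‖y−y_i‖²} e^{−η'‖y−y_j‖²}, where B = c_{2η} · (A ∘ K_{X,X,η/2}) with c_{2η} = (π/(2η))^{d/2}, (K_{X,X,η/2})_{ij} = e^{−(η/2)‖x_i−x_j‖²}, and ∘ denoting the entrywise (Hadamard) product; moreover B is symmetric positive semidefinite, so the marginal is again a Gaussian PSD model. -/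

import Mathlib

open MeasureTheory Real

noncomputable section

abbrev Rn (n : ℕ) := EuclideanSpace ℝ (Fin n)

section GaussianKernel

variable {V : Type*} [NormedAddCommGroup V] [InnerProductSpace ℝ V]

lemma exp_neg_mul_sq_norm_sub_mul (η : ℝ) (a b x : V) :
    Real.exp (-η * ‖x - a‖ ^ 2) * Real.exp (-η * ‖x - b‖ ^ 2) =
      Real.exp (-(η / 2) * ‖a - b‖ ^ 2) *
        Real.exp (-(2 * η) * ‖x - (2⁻¹ : ℝ) • (a + b)‖ ^ 2) := by
  have h := parallelogram_law_with_norm ℝ (x - a) (x - b)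
  have hsum : x - a + (x - b) = (2 : ℝ) • (x - (2⁻¹ : ℝ) • (a + b)) := by module
  have hsub : x - a - (x - b) = -(a - b) := by abel
  rw [hsum, hsub, norm_neg, norm_smul, Real.norm_ofNat] at h
  rw [← Real.exp_add, ← Real.exp_add]
  congr 1
  linear_combination (η / 2) * h

variable [FiniteDimensional ℝ V] [MeasurableSpace V] [BorelSpace V] {η : ℝ}

lemma integrable_exp_neg_mul_sq_norm (hη : 0 < η) :
    Integrable fun x : V => Real.exp (-η * ‖x‖ ^ 2) := by
  have h := (GaussianFourier.integrable_cexp_neg_mul_sq_norm_add (V := V) (b := (η : ℂ))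
    (by simpa using hη) 0 0).norm
  refine h.congr (.of_forall fun x => ?_)
  simp [Complex.norm_exp, ← Complex.ofReal_pow]

lemma integrable_exp_neg_mul_sq_norm_sub_mul (hη : 0 < η) (a b : V) :
    Integrable fun x : V =>
      Real.exp (-η * ‖x - a‖ ^ 2) * Real.exp (-η * ‖x - b‖ ^ 2) := by
  simp_rw [exp_neg_mul_sq_norm_sub_mul]
  exact ((integrable_exp_neg_mul_sq_norm (by positivity : 0 < 2 * η)).comp_sub_right _).const_mul _

lemma integral_exp_neg_mul_sq_norm_sub_mul (hη : 0 < η) (a b : V) :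
    ∫ x : V, Real.exp (-η * ‖x - a‖ ^ 2) * Real.exp (-η * ‖x - b‖ ^ 2) =
      (Real.pi / (2 * η)) ^ ((Module.finrank ℝ V : ℝ) / 2) *
        Real.exp (-(η / 2) * ‖a - b‖ ^ 2) := by
  simp_rw [exp_neg_mul_sq_norm_sub_mul]
  rw [integral_const_mul,
    integral_sub_right_eq_self (fun x : V => Real.exp (-(2 * η) * ‖x‖ ^ 2)),
    GaussianFourier.integral_rexp_neg_mul_sq_norm (by positivity), mul_comm]

lemma integral_sum_mul_exp_neg_mul_sq_norm_sub {ι : Type*} [Fintype ι] (hη : 0 < η)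
    (X : ι → V) (M : ι → ι → ℝ) :
    ∫ x : V, ∑ i, ∑ j,
        M i j * (Real.exp (-η * ‖x - X i‖ ^ 2) * Real.exp (-η * ‖x - X j‖ ^ 2)) =
      ∑ i, ∑ j, M i j * ((Real.pi / (2 * η)) ^ ((Module.finrank ℝ V : ℝ) / 2) *
        Real.exp (-(η / 2) * ‖X i - X j‖ ^ 2)) := by
  have hint (i j : ι) := (integrable_exp_neg_mul_sq_norm_sub_mul hη (X i) (X j)).const_mul (M i j)
  rw [integral_finsetSum _ fun i _ => integrable_finsetSum _ fun j _ => hint i j]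
  refine Finset.sum_congr rfl fun i _ => ?_
  rw [integral_finsetSum _ fun j _ => hint i j]
  refine Finset.sum_congr rfl fun j _ => ?_
  rw [integral_const_mul, integral_exp_neg_mul_sq_norm_sub_mul hη]

end GaussianKernel

/-- Marginalization of a joint Gaussian PSD model in the first variable:
for `B = c_{2η} (A ∘ K_{X,X,η/2})` (Hadamard product, `c_{2η} = (π/(2η))^{d/2}`), the matrix `B`
is symmetric positive semidefinite and for every `y`,
`∫ f(x,y) dx = Σ_{i,j} B_{ij} e^{-η'‖y-y_i‖²} e^{-η'‖y-y_j‖²}`. -/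
theorem gaussian_psd_model_marginalization (d d' n : ℕ) (η η' : ℝ) (hη : 0 < η) (hη' : 0 < η')
    (X : Fin n → Rn d) (Y : Fin n → Rn d')
    (A : Matrix (Fin n) (Fin n) ℝ) (hA : A.PosSemidef)
    (B : Matrix (Fin n) (Fin n) ℝ)
    (hB : ∀ i j, B i j = (Real.pi / (2 * η)) ^ ((d : ℝ) / 2) *
      (A i j * Real.exp (-(η / 2) * ‖X i - X j‖ ^ 2))) :
    B.PosSemidef ∧
    ∀ y : Rn d',
      (∫ x : Rn d, ∑ i : Fin n, ∑ j : Fin n,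
          A i j * Real.exp (-η * ‖x - X i‖ ^ 2) * Real.exp (-η' * ‖y - Y i‖ ^ 2)
            * Real.exp (-η * ‖x - X j‖ ^ 2) * Real.exp (-η' * ‖y - Y j‖ ^ 2))
        = ∑ i : Fin n, ∑ j : Fin n,
            B i j * Real.exp (-η' * ‖y - Y i‖ ^ 2) * Real.exp (-η' * ‖y - Y j‖ ^ 2) := by
  constructor
  · refine .of_dotProduct_mulVec_nonneg ?_ fun v => ?_
    · ext i j
      have hAij : A j i = A i j := by simpa using hA.isHermitian.apply i j
      simp [hB, hAij, norm_sub_rev (X j) (X i)]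
    · have h := integral_sum_mul_exp_neg_mul_sq_norm_sub hη X fun i j => v i * A i j * v j
      rw [finrank_euclideanSpace_fin] at h
      have hquad : star v ⬝ᵥ B.mulVec v = ∑ i, ∑ j, v i * A i j * v j *
          ((Real.pi / (2 * η)) ^ ((d : ℝ) / 2) * Real.exp (-(η / 2) * ‖X i - X j‖ ^ 2)) := by
        simp only [dotProduct, Matrix.mulVec, Finset.mul_sum, hB, Pi.star_apply, star_trivial]
        refine Finset.sum_congr rfl fun i _ => Finset.sum_congr rfl fun j _ => ?_
        ring
      rw [hquad, ← h]
      refine integral_nonneg fun x => ?_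
      have hnonneg := hA.dotProduct_mulVec_nonneg fun i => v i * Real.exp (-η * ‖x - X i‖ ^ 2)
      simp only [dotProduct, Matrix.mulVec, Finset.mul_sum, Pi.star_apply, star_trivial] at hnonneg
      refine hnonneg.trans_eq ?_
      refine Finset.sum_congr rfl fun i _ => Finset.sum_congr rfl fun j _ => ?_
      ring
  · intro y
    have h := integral_sum_mul_exp_neg_mul_sq_norm_sub hη X fun i j =>
      A i j * Real.exp (-η' * ‖y - Y i‖ ^ 2) * Real.exp (-η' * ‖y - Y j‖ ^ 2)
    rw [finrank_euclideanSpace_fin] at h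
    convert h using 1
    · refine integral_congr_ae (.of_forall fun x => ?_)
      refine Finset.sum_congr rfl fun i _ => Finset.sum_congr rfl fun j _ => ?_
      ring
    · refine Finset.sum_congr rfl fun i _ => Finset.sum_congr rfl fun j _ => ?_
      rw [hB]
      ring
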